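/- The five K-linear maps from V ⊗ V ⊗ V to V ⊗ V ⊗ V given by id_{V⊗V⊗V}, id_V ⊗ (⟨Cup⟩∘⟨Cap⟩), (⟨Cup⟩∘⟨Cap⟩) ⊗ id_V, (id_V ⊗ ⟨Cup⟩) ∘ (⟨Cap⟩ ⊗ id_V), and (⟨Cup⟩ ⊗ id_V) ∘ (id_V ⊗ ⟨Cap⟩) (with the obvious identifications V ⊗ K ≅ V ≅ K ⊗ V) are linearly independent over K. (These are the Kauffman amplitudes of the five basic stills S₁^{3,3} = 1₃, S₂^{3,3} = [1,Cap,0][1,Cup,0], S₃^{3,3} = [0,Cap,1][0,Cup,1], S₄^{3,3} = [0,Cap,1][1,Cup,0], S₅^{3,3} = [1,Cap,0][0,Cup,1]; their linear independence is the uniqueness assertion implicit in the paper's definition of normal coordinates for the case (m,n) = (3,3).) -/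

import Mathlib

set_option synthInstance.maxHeartbeats 1000000
set_option maxHeartbeats 1000000

noncomputable section

open TensorProduct

/-- The ground field `K = ℚ(q)`. -/
abbrev K : Type := RatFunc ℚ

/-- The 2-dimensional `K`-vector space `V` with basis `e 0, e 1`. -/
abbrev V : Type := Fin 2 → K

/-- The indeterminate `q`. -/
noncomputable def q : K := RatFunc.X

/-- The basis vectors `e₀, e₁` of `V`. -/
noncomputable def e : Fin 2 → V := fun i => Pi.single i (1 : K)

/-- The standard basis of `V`. -/
noncomputable def Vbasis : Module.Basis (Fin 2) K V := Pi.basisFun K (Fin 2)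

/-- The induced basis `e i ⊗ e j` of `V ⊗ V`. -/
noncomputable def VVbasis : Module.Basis (Fin 2 × Fin 2) K (V ⊗[K] V) :=
  Vbasis.tensorProduct Vbasis

/-- Kauffman amplitude of `Cup`: `1 ↦ -q·e₀⊗e₁ + q⁻¹·e₁⊗e₀`. -/
noncomputable def Cup : K →ₗ[K] V ⊗[K] V :=
  LinearMap.toSpanSingleton K (V ⊗[K] V)
    ((-q) • (e 0 ⊗ₜ[K] e 1) + q⁻¹ • (e 1 ⊗ₜ[K] e 0))

/-- Kauffman amplitude of `Cap`: `e₀⊗e₀ ↦ 0`, `e₁⊗e₁ ↦ 0`, `e₀⊗e₁ ↦ q`, `e₁⊗e₀ ↦ -q⁻¹`. -/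
noncomputable def Cap : V ⊗[K] V →ₗ[K] K :=
  VVbasis.constr K fun p =>
    if p = (0, 1) then q else if p = (1, 0) then -q⁻¹ else 0

/-- Kauffman amplitude of `NE`. -/
noncomputable def NE : V ⊗[K] V →ₗ[K] V ⊗[K] V :=
  VVbasis.constr K fun p =>
    if p = (0, 0) then q • (e 0 ⊗ₜ[K] e 0)
    else if p = (1, 1) then q • (e 1 ⊗ₜ[K] e 1)
    else if p = (0, 1) then q⁻¹ • (e 1 ⊗ₜ[K] e 0)
    else q⁻¹ • (e 0 ⊗ₜ[K] e 1) + (q - q⁻¹ ^ 3) • (e 1 ⊗ₜ[K] e 0)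

/-- Kauffman amplitude of `NW`. -/
noncomputable def NW : V ⊗[K] V →ₗ[K] V ⊗[K] V :=
  VVbasis.constr K fun p =>
    if p = (0, 0) then q⁻¹ • (e 0 ⊗ₜ[K] e 0)
    else if p = (1, 1) then q⁻¹ • (e 1 ⊗ₜ[K] e 1)
    else if p = (1, 0) then q • (e 0 ⊗ₜ[K] e 1)
    else (q⁻¹ - q ^ 3) • (e 0 ⊗ₜ[K] e 1) + q • (e 1 ⊗ₜ[K] e 0)

/-- `S₁^{3,3} = 1₃`. -/
noncomputable def M1 : (V ⊗[K] V) ⊗[K] V →ₗ[K] (V ⊗[K] V) ⊗[K] V := LinearMap.id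

/-- `S₂^{3,3} = [1,Cap,0][1,Cup,0]`, i.e. `id_V ⊗ (⟨Cup⟩ ∘ ⟨Cap⟩)`. -/
noncomputable def M2 : (V ⊗[K] V) ⊗[K] V →ₗ[K] (V ⊗[K] V) ⊗[K] V :=
  (TensorProduct.assoc K V V V).symm.toLinearMap ∘ₗ
    TensorProduct.map (LinearMap.id : V →ₗ[K] V) (Cup ∘ₗ Cap) ∘ₗ
    (TensorProduct.assoc K V V V).toLinearMap

/-- `S₃^{3,3} = [0,Cap,1][0,Cup,1]`, i.e. `(⟨Cup⟩ ∘ ⟨Cap⟩) ⊗ id_V`. -/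
noncomputable def M3 : (V ⊗[K] V) ⊗[K] V →ₗ[K] (V ⊗[K] V) ⊗[K] V :=
  TensorProduct.map (Cup ∘ₗ Cap) (LinearMap.id : V →ₗ[K] V)

/-- `S₄^{3,3} = [0,Cap,1][1,Cup,0]`, i.e. `(id_V ⊗ ⟨Cup⟩) ∘ (⟨Cap⟩ ⊗ id_V)`. -/
noncomputable def M4 : (V ⊗[K] V) ⊗[K] V →ₗ[K] (V ⊗[K] V) ⊗[K] V :=
  (TensorProduct.assoc K V V V).symm.toLinearMap ∘ₗ
    TensorProduct.map (LinearMap.id : V →ₗ[K] V) Cup ∘ₗ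
    (TensorProduct.rid K V).symm.toLinearMap ∘ₗ
    (TensorProduct.lid K V).toLinearMap ∘ₗ
    TensorProduct.map Cap (LinearMap.id : V →ₗ[K] V)

/-- `S₅^{3,3} = [1,Cap,0][0,Cup,1]`, i.e. `(⟨Cup⟩ ⊗ id_V) ∘ (id_V ⊗ ⟨Cap⟩)`. -/
noncomputable def M5 : (V ⊗[K] V) ⊗[K] V →ₗ[K] (V ⊗[K] V) ⊗[K] V :=
  TensorProduct.map Cup (LinearMap.id : V →ₗ[K] V) ∘ₗ
    (TensorProduct.lid K V).symm.toLinearMap ∘ₗ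
    (TensorProduct.rid K V).toLinearMap ∘ₗ
    TensorProduct.map (LinearMap.id : V →ₗ[K] V) Cap ∘ₗ
    (TensorProduct.assoc K V V V).toLinearMap

theorem aux_q_ne : q ≠ 0 := RatFunc.X_ne_zero

theorem aux_Cup_one : Cup 1 = (-q) • (e 0 ⊗ₜ[K] e 1) + q⁻¹ • (e 1 ⊗ₜ[K] e 0) := by
  simp only [Cup, LinearMap.toSpanSingleton_apply, one_smul]

theorem aux_Cup (c : K) :
    Cup c = c • ((-q) • (e 0 ⊗ₜ[K] e 1) + q⁻¹ • (e 1 ⊗ₜ[K] e 0)) := by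
  simp only [Cup, LinearMap.toSpanSingleton_apply]

theorem aux_Cap (i j : Fin 2) : Cap (e i ⊗ₜ[K] e j) =
    if (i, j) = ((0, 1) : Fin 2 × Fin 2) then q
      else if (i, j) = ((1, 0) : Fin 2 × Fin 2) then -q⁻¹ else 0 := by
  have h : e i ⊗ₜ[K] e j = VVbasis (i, j) := by
    rw [VVbasis, Module.Basis.tensorProduct_apply, Vbasis, Pi.basisFun_apply, Pi.basisFun_apply]
    rfl
  rw [h, Cap, Module.Basis.constr_basis]

theorem aux_Cap00 : Cap (e 0 ⊗ₜ[K] e 0) = 0 := by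
  rw [aux_Cap, if_neg (by decide), if_neg (by decide)]

theorem aux_Cap01 : Cap (e 0 ⊗ₜ[K] e 1) = q := by
  rw [aux_Cap, if_pos (by decide)]

theorem aux_Cap10 : Cap (e 1 ⊗ₜ[K] e 0) = -q⁻¹ := by
  rw [aux_Cap, if_neg (by decide), if_pos (by decide)]

/-- The coordinate functionals on the triple tensor product. -/
def coord3 (a b c : Fin 2) : (V ⊗[K] V) ⊗[K] V →ₗ[K] K :=
  LinearMap.mul' K K ∘ₗ TensorProduct.map
    (LinearMap.mul' K K ∘ₗ TensorProduct.map (LinearMap.proj a) (LinearMap.proj b))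
    (LinearMap.proj c)

theorem coord3_tmul (a b c : Fin 2) (x y z : V) :
    coord3 a b c ((x ⊗ₜ[K] y) ⊗ₜ[K] z) = x a * y b * z c := rfl

theorem aux_M1 (x : (V ⊗[K] V) ⊗[K] V) : M1 x = x := rfl

theorem aux_M2 (x y z : V) : M2 ((x ⊗ₜ[K] y) ⊗ₜ[K] z) = Cap (y ⊗ₜ[K] z) •
    ((-q) • ((x ⊗ₜ[K] e 0) ⊗ₜ[K] e 1) + q⁻¹ • ((x ⊗ₜ[K] e 1) ⊗ₜ[K] e 0)) := by
  simp only [M2, LinearMap.comp_apply, LinearEquiv.coe_coe, TensorProduct.assoc_tmul,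
    TensorProduct.map_tmul, LinearMap.id_apply, aux_Cup, TensorProduct.tmul_smul,
    TensorProduct.tmul_add, map_smul, map_add, TensorProduct.assoc_symm_tmul]

theorem aux_M3 (x y z : V) : M3 ((x ⊗ₜ[K] y) ⊗ₜ[K] z) = Cap (x ⊗ₜ[K] y) •
    ((-q) • ((e 0 ⊗ₜ[K] e 1) ⊗ₜ[K] z) + q⁻¹ • ((e 1 ⊗ₜ[K] e 0) ⊗ₜ[K] z)) := by
  simp only [M3, LinearMap.comp_apply,
    TensorProduct.map_tmul, LinearMap.id_apply, aux_Cup, ← TensorProduct.smul_tmul',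
    TensorProduct.add_tmul]

theorem aux_M4 (x y z : V) : M4 ((x ⊗ₜ[K] y) ⊗ₜ[K] z) = Cap (x ⊗ₜ[K] y) •
    ((-q) • ((z ⊗ₜ[K] e 0) ⊗ₜ[K] e 1) + q⁻¹ • ((z ⊗ₜ[K] e 1) ⊗ₜ[K] e 0)) := by
  simp only [M4, LinearMap.comp_apply, LinearEquiv.coe_coe, TensorProduct.lid_tmul,
    TensorProduct.rid_symm_apply, ← TensorProduct.smul_tmul',
    TensorProduct.map_tmul, LinearMap.id_apply, aux_Cup_one, TensorProduct.tmul_smul,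
    TensorProduct.tmul_add, map_smul, map_add, TensorProduct.assoc_symm_tmul]

theorem aux_M5 (x y z : V) : M5 ((x ⊗ₜ[K] y) ⊗ₜ[K] z) = Cap (y ⊗ₜ[K] z) •
    ((-q) • ((e 0 ⊗ₜ[K] e 1) ⊗ₜ[K] x) + q⁻¹ • ((e 1 ⊗ₜ[K] e 0) ⊗ₜ[K] x)) := by
  simp only [M5, LinearMap.comp_apply, LinearEquiv.coe_coe, TensorProduct.assoc_tmul,
    TensorProduct.rid_tmul, map_smul,
    TensorProduct.lid_symm_apply, TensorProduct.tmul_smul, ← TensorProduct.smul_tmul',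
    TensorProduct.map_tmul, LinearMap.id_apply, aux_Cup_one,
    TensorProduct.add_tmul]

theorem aux_e00 : e 0 0 = 1 := rfl
theorem aux_e11 : e 1 1 = 1 := rfl
theorem aux_e01 : e 0 1 = 0 := rfl
theorem aux_e10 : e 1 0 = 0 := rfl

/-- The Kauffman amplitudes of the five basic (3,3)-stills are linearly independent. -/
theorem basic_stills_33_linearIndependent :
    LinearIndependent K ![M1, M2, M3, M4, M5] := by
  have hq := aux_q_ne
  refine (Fintype.linearIndependent_iffₛ (ι := Fin 5) (R := K)
    (v := ![M1, M2, M3, M4, M5])).mpr ?_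
  intro f f' hff
  obtain ⟨g, hgdef⟩ : ∃ g : Fin 5 → K, ∀ i, g i = f i - f' i := ⟨fun i => f i - f' i, fun _ => rfl⟩
  suffices hgz : ∀ i, g i = 0 from fun i => sub_eq_zero.mp ((hgdef i).symm.trans (hgz i))
  have key : ∀ (a b c i j k : Fin 2),
      g 0 * coord3 a b c (M1 ((e i ⊗ₜ[K] e j) ⊗ₜ[K] e k)) +
      g 1 * coord3 a b c (M2 ((e i ⊗ₜ[K] e j) ⊗ₜ[K] e k)) +
      g 2 * coord3 a b c (M3 ((e i ⊗ₜ[K] e j) ⊗ₜ[K] e k)) +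
      g 3 * coord3 a b c (M4 ((e i ⊗ₜ[K] e j) ⊗ₜ[K] e k)) +
      g 4 * coord3 a b c (M5 ((e i ⊗ₜ[K] e j) ⊗ₜ[K] e k)) = 0 := by
    intro a b c i j k
    have h : f 0 • M1 + f 1 • M2 + f 2 • M3 + f 3 • M4 + f 4 • M5 =
        f' 0 • M1 + f' 1 • M2 + f' 2 • M3 + f' 3 • M4 + f' 4 • M5 := by
      rw [Fin.sum_univ_five, Fin.sum_univ_five] at hff
      exact hff
    have h2 := congrArg (fun m => coord3 a b c (m ((e i ⊗ₜ[K] e j) ⊗ₜ[K] e k))) h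
    simp only [LinearMap.add_apply, LinearMap.smul_apply, map_add, map_smul, smul_eq_mul] at h2
    simp only [hgdef]
    linear_combination h2
  simp only [aux_M1, aux_M2, aux_M3, aux_M4, aux_M5, map_smul, map_add, coord3_tmul,
    smul_eq_mul] at key
  have k0 := key 0 0 0 0 0 0
  have k1 := key 1 0 0 0 0 1
  have k2 := key 0 0 1 0 0 1
  have k3 := key 0 0 1 1 0 0
  have k4 := key 1 0 0 1 0 0
  simp only [aux_Cap00, aux_Cap01, aux_Cap10, aux_e00, aux_e01, aux_e10, aux_e11, mul_zero,
    zero_mul, mul_one, add_zero, zero_add] at k0 k1 k2 k3 k4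
  have g0 : g 0 = 0 := k0
  simp only [g0, zero_mul, zero_add] at k1 k2 k3 k4
  have g4 : g 4 = 0 := by simpa [hq] using k1
  have g1 : g 1 = 0 := by simpa [hq] using k2
  have g3 : g 3 = 0 := by simpa [hq] using k3
  have g2 : g 2 = 0 := by simpa [hq, g1, g3, g4] using k4
  intro i
  fin_cases i
  exacts [g0, g1, g2, g3, g4]
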